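/- Let D and D' be bounded domains in ℂ, p > 2, let f : D → D' be a Q-homeomorphism with respect to the p-modulus with Q ∈ L¹_loc(D \ {z₀}), let z₀ ∈ D, and let 0 < t < t + Δt < dist(z₀, ∂D). Then 2·sqrt(π·|f(B(z₀,t))|) ≤ (2π)^{1/p} · ( |f(B(z₀,t+Δt))| − |f(B(z₀,t))| )^{(p−1)/p} / ln((t+Δt)/t) · ( ∫_t^{t+Δt} τ^{1−p} · q_{z₀}(τ) dτ )^{1/p}, where B(z₀,s) = {z : |z − z₀| ≤ s} and |E| denotes the area (2-dimensional Lebesgue measure) of E. -/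

import Mathlib

open MeasureTheory Set Metric Complex ENNReal

noncomputable section

open Classical in
/-- The line integral `∫_γ ρ |dz|` of a Borel density `ρ` along a curve `γ`
(parametrized on `[0,1]`), with the convention that the integral is `∞`
for curves that are not rectifiable (here: not Lipschitz on `[0,1]`). -/
def lineIntegral (ρ : ℂ → ℝ≥0∞) (γ : ℝ → ℂ) : ℝ≥0∞ :=
  if ∃ K : NNReal, LipschitzOnWith K γ (Set.Icc 0 1) then
    ∫⁻ t in Set.Icc (0 : ℝ) 1, ρ (γ t) * (‖deriv γ t‖₊ : ℝ≥0∞)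
  else ⊤

/-- A Borel function `ρ : ℂ → [0,∞]` is admissible for the curve family `Γ`
if `∫_γ ρ |dz| ≥ 1` for every `γ ∈ Γ`. -/
def IsAdmissible (ρ : ℂ → ℝ≥0∞) (Γ : Set (ℝ → ℂ)) : Prop :=
  Measurable ρ ∧ ∀ γ ∈ Γ, 1 ≤ lineIntegral ρ γ

/-- The `p`-modulus of a family `Γ` of curves in `ℂ`:
`M_p(Γ) = inf { ∫_ℂ ρ^p dm : ρ admissible for Γ }`. -/
def pModulus (p : ℝ) (Γ : Set (ℝ → ℂ)) : ℝ≥0∞ :=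
  ⨅ (ρ : ℂ → ℝ≥0∞) (_ : IsAdmissible ρ Γ), ∫⁻ z : ℂ, ρ z ^ p

/-- `Γ` is a family of curves lying in the set `D`. -/
def CurveFamilyIn (Γ : Set (ℝ → ℂ)) (D : Set ℂ) : Prop :=
  ∀ γ ∈ Γ, ContinuousOn γ (Set.Icc 0 1) ∧ ∀ t ∈ Set.Icc (0 : ℝ) 1, γ t ∈ D

/-- `f` is a homeomorphism of `D` onto its image: continuous, injective and open on `D`. -/
def IsHomeoOn (f : ℂ → ℂ) (D : Set ℂ) : Prop :=
  ContinuousOn f D ∧ Set.InjOn f D ∧ ∀ U ⊆ D, IsOpen U → IsOpen (f '' U)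

/-- `f` is a `Q`-homeomorphism with respect to the `p`-modulus on `D`:
`M_p(fΓ) ≤ ∫_D Q(z) ρ(z)^p dm(z)` for every curve family `Γ` in `D` and every
`ρ` admissible for `Γ`. -/
def IsQHomeo (p : ℝ) (D : Set ℂ) (Q : ℂ → ℝ≥0∞) (f : ℂ → ℂ) : Prop :=
  IsHomeoOn f D ∧
    ∀ Γ : Set (ℝ → ℂ), CurveFamilyIn Γ D → ∀ ρ : ℂ → ℝ≥0∞, IsAdmissible ρ Γ →
      pModulus p ((fun γ => f ∘ γ) '' Γ) ≤ ∫⁻ z in D, Q z * ρ z ^ p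

/-- The integral mean `q_{z₀}(r) = (1/(2πr)) ∫_{S(z₀,r)} Q(z) |dz|` of `Q` over the
circle `S(z₀,r)`, computed via the arclength parametrization `θ ↦ z₀ + r e^{iθ}`. -/
def circleMean (Q : ℂ → ℝ≥0∞) (z₀ : ℂ) (r : ℝ) : ℝ≥0∞ :=
  (∫⁻ θ in Set.Icc (0 : ℝ) (2 * Real.pi),
      Q (z₀ + (r : ℂ) * Complex.exp ((θ : ℂ) * Complex.I))) / ENNReal.ofReal (2 * Real.pi)

section

open scoped Pointwise

/-- Layer-cake formula for a `[0,1]`-valued function. -/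
theorem lintegral_eq_setLIntegral_Ioo_meas_lt {α : Type*} [MeasurableSpace α] (μ : Measure α)
    [SFinite μ] {g : α → ℝ≥0∞} (hg : Measurable g) (hg1 : ∀ x, g x ≤ 1) :
    ∫⁻ x, g x ∂μ = ∫⁻ s in Ioo (0 : ℝ) 1, μ {x | ENNReal.ofReal s < g x} := by
  have hm : MeasurableSet {q : ℝ × α | ENNReal.ofReal q.1 < g q.2} :=
    measurableSet_lt (by fun_prop) (by fun_prop)
  have h1 : ∀ s : ℝ, μ {x | ENNReal.ofReal s < g x} =
      ∫⁻ x, {q : ℝ × α | ENNReal.ofReal q.1 < g q.2}.indicator 1 (s, x) ∂μ := fun s => by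
    exact (lintegral_indicator_one (hm.preimage measurable_prodMk_left)).symm
  simp_rw [h1]
  rw [lintegral_lintegral_swap
    (f := fun (s : ℝ) (x : α) => {q : ℝ × α | ENNReal.ofReal q.1 < g q.2}.indicator 1 (s, x))
    ((measurable_one.indicator hm).aemeasurable)]
  refine lintegral_congr fun x => ?_
  have h2 : (fun s : ℝ => {q : ℝ × α | ENNReal.ofReal q.1 < g q.2}.indicator
      (1 : ℝ × α → ℝ≥0∞) (s, x)) = {s : ℝ | ENNReal.ofReal s < g x}.indicator 1 := rfl
  have hx : g x ≠ ⊤ := ((hg1 x).trans_lt one_lt_top).ne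
  have hx1 : (g x).toReal ≤ 1 := ENNReal.toReal_le_of_le_ofReal zero_le_one (by simpa using hg1 x)
  have hs : MeasurableSet {s : ℝ | ENNReal.ofReal s < g x} := hm.preimage measurable_prodMk_right
  rw [h2, lintegral_indicator_one hs, Measure.restrict_apply hs]
  have h3 : {s : ℝ | ENNReal.ofReal s < g x} ∩ Ioo 0 1 = Ioo 0 (g x).toReal := by
    ext s
    simp only [mem_inter_iff, mem_ofPred_eq, mem_Ioo]
    constructor
    · rintro ⟨h, h0, -⟩
      exact ⟨h0, (ENNReal.ofReal_lt_iff_lt_toReal h0.le hx).1 h⟩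
    · rintro ⟨h0, h⟩
      exact ⟨(ENNReal.ofReal_lt_iff_lt_toReal h0.le hx).2 h, h0, h.trans_le hx1⟩
  rw [h3, Real.volume_Ioo, sub_zero, ENNReal.ofReal_toReal hx]

theorem setLIntegral_Ioo_meas_lt_le {α : Type*} [MeasurableSpace α] (μ : Measure α)
    [SFinite μ] {g : α → ℝ≥0∞} (hg : Measurable g) :
    ∫⁻ s in Ioo (0 : ℝ) 1, μ {x | ENNReal.ofReal s < g x} ≤ ∫⁻ x, g x ∂μ := by
  calc ∫⁻ s in Ioo (0 : ℝ) 1, μ {x | ENNReal.ofReal s < g x}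
      = ∫⁻ s in Ioo (0 : ℝ) 1, μ {x | ENNReal.ofReal s < min (g x) 1} := by
        refine setLIntegral_congr_fun measurableSet_Ioo fun s hs => ?_
        have : ENNReal.ofReal s < 1 := by simpa using hs.2
        simp [this]
    _ = ∫⁻ x, min (g x) 1 ∂μ :=
        (lintegral_eq_setLIntegral_Ioo_meas_lt μ (hg.min measurable_const)
          fun x => min_le_right _ _).symm
    _ ≤ ∫⁻ x, g x ∂μ := lintegral_mono fun x => min_le_left _ _

/-- The one-dimensional Brunn–Minkowski inequality for compact sets. -/
theorem IsCompact.volume_add_volume_le_real {K L : Set ℝ} (hK : IsCompact K) (hL : IsCompact L)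
    (hK0 : K.Nonempty) (hL0 : L.Nonempty) : volume K + volume L ≤ volume (K + L) := by
  have ha := hK.sSup_mem hK0
  have hb := hL.sInf_mem hL0
  set a := sSup K
  set b := sInf L
  have e1 : volume K = volume ((fun x => x + b) '' K) := by simp
  have e2 : volume L = volume ((fun x => a + x) '' L) := by simp
  have hd : AEDisjoint volume ((fun x => x + b) '' K) ((fun x => a + x) '' L) := by
    refine measure_mono_null (t := {a + b}) ?_ (by simp)
    rintro _ ⟨⟨x, hx, rfl⟩, ⟨y, hy, hxy⟩⟩
    have h1 : x ≤ a := le_csSup hK.bddAbove hx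
    have h2 : b ≤ y := csInf_le hL.bddBelow hy
    simp only at hxy ⊢
    rw [mem_singleton_iff]
    linarith
  rw [e1, e2, ← measure_union₀ (hL.image (by fun_prop)).measurableSet.nullMeasurableSet hd]
  refine measure_mono (union_subset ?_ ?_)
  · rintro _ ⟨x, hx, rfl⟩
    exact add_mem_add hx hb
  · rintro _ ⟨x, hx, rfl⟩
    exact add_mem_add ha hx

/-- The one-dimensional Brunn–Minkowski inequality. -/
theorem MeasurableSet.volume_add_volume_le_real {A B : Set ℝ} (hA : MeasurableSet A)
    (hB : MeasurableSet B) (hA0 : A.Nonempty) (hB0 : B.Nonempty) :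
    volume A + volume B ≤ volume (A + B) := by
  obtain ⟨a, ha⟩ := hA0
  obtain ⟨b, hb⟩ := hB0
  have key : ∀ K ⊆ A, IsCompact K → ∀ L ⊆ B, IsCompact L →
      volume K + volume L ≤ volume (A + B) := by
    intro K hKA hK L hLB hL
    rcases K.eq_empty_or_nonempty with rfl | hK0
    · have : volume L = volume ((fun x => a + x) '' L) := by simp
      rw [measure_empty, zero_add, this]
      refine measure_mono ?_
      rintro _ ⟨x, hx, rfl⟩
      exact add_mem_add ha (hLB hx)
    rcases L.eq_empty_or_nonempty with rfl | hL0
    · have : volume K = volume ((fun x => x + b) '' K) := by simp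
      rw [measure_empty, add_zero, this]
      refine measure_mono ?_
      rintro _ ⟨x, hx, rfl⟩
      exact add_mem_add (hKA hx) hb
    exact (hK.volume_add_volume_le_real hL hK0 hL0).trans (measure_mono (add_subset_add hKA hLB))
  rw [hA.measure_eq_iSup_isCompact, hB.measure_eq_iSup_isCompact]
  simp only [iSup_and']
  exact ENNReal.biSup_add_biSup_le' ⟨∅, by simp⟩ ⟨∅, by simp⟩
    fun K hK L hL => key K hK.1 hK.2 L hL.1 hL.2

/-- The Brunn–Minkowski inequality in the plane, for bounded open sets. -/
theorem IsOpen.sq_sqrt_volume_add_sqrt_volume_le {A B : Set (ℝ × ℝ)} (hA : IsOpen A)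
    (hB : IsOpen B) (hA0 : A.Nonempty) (hB0 : B.Nonempty) (hAb : Bornology.IsBounded A)
    (hBb : Bornology.IsBounded B) :
    (√(volume A).toReal + √(volume B).toReal) ^ 2 ≤ (volume (A + B)).toReal := by
  have sec : ∀ {S : Set (ℝ × ℝ)}, IsOpen S → S.Nonempty → Bornology.IsBounded S →
      ∃ M : ℝ≥0∞, M ≠ 0 ∧ M ≠ ⊤ ∧ (⨆ x : ℝ, volume (Prod.mk x ⁻¹' S)) = M := by
    intro S hS ⟨q, hq⟩ hSb
    refine ⟨_, ?_, ?_, rfl⟩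
    · have h1 : 0 < volume (Prod.mk q.1 ⁻¹' S) :=
        (hS.preimage (Continuous.prodMk_right q.1)).measure_pos volume ⟨q.2, hq⟩
      exact (h1.trans_le (le_iSup (fun x : ℝ => volume (Prod.mk x ⁻¹' S)) q.1)).ne'
    · obtain ⟨R, hR⟩ := hSb.subset_closedBall 0
      refine ((iSup_le fun x => measure_mono (t := closedBall (0 : ℝ) R) ?_).trans_lt
        measure_closedBall_lt_top).ne
      intro y hy
      have := hR hy
      rw [mem_closedBall_zero_iff] at this ⊢
      exact (norm_snd_le (x, y)).trans this
  obtain ⟨M, hM0, hMt, hM⟩ := sec hA hA0 hAb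
  obtain ⟨N, hN0, hNt, hN⟩ := sec hB hB0 hBb
  have hC : IsOpen (A + B) := hA.add_right
  have hCb : Bornology.IsBounded (A + B) := hAb.add hBb
  have hm : ∀ {S : Set (ℝ × ℝ)} (P : ℝ≥0∞), IsOpen S →
      Measurable fun x : ℝ => volume (Prod.mk x ⁻¹' S) / P := fun P hS =>
    (measurable_measure_prodMk_left hS.measurableSet).div_const P
  have hdiv : ∀ {S : Set (ℝ × ℝ)} (P : ℝ≥0∞), IsOpen S →
      ∫⁻ x : ℝ, volume (Prod.mk x ⁻¹' S) / P = volume S / P := by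
    intro S P hS
    simp_rw [div_eq_mul_inv]
    rw [lintegral_mul_const _ (measurable_measure_prodMk_left hS.measurableSet),
      Measure.volume_eq_prod, Measure.prod_apply hS.measurableSet]
  have layer : ∀ {S : Set (ℝ × ℝ)} {P : ℝ≥0∞}, IsOpen S →
      (⨆ x : ℝ, volume (Prod.mk x ⁻¹' S)) = P →
      volume S / P = ∫⁻ s in Ioo (0 : ℝ) 1,
        volume {x : ℝ | ENNReal.ofReal s < volume (Prod.mk x ⁻¹' S) / P} := by
    intro S P hS hP
    rw [← lintegral_eq_setLIntegral_Ioo_meas_lt volume (hm P hS), hdiv P hS]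
    intro x
    refine ENNReal.div_le_of_le_mul ?_
    rw [one_mul, ← hP]
    exact le_iSup (fun x : ℝ => volume (Prod.mk x ⁻¹' S)) x
  have hne : ∀ {S : Set (ℝ × ℝ)} {P : ℝ≥0∞}, P ≠ 0 → P ≠ ⊤ →
      (⨆ x : ℝ, volume (Prod.mk x ⁻¹' S)) = P → ∀ s ∈ Ioo (0 : ℝ) 1,
      {x : ℝ | ENNReal.ofReal s < volume (Prod.mk x ⁻¹' S) / P}.Nonempty := by
    intro S P hP0 hPt hP s hs
    have h1 : ENNReal.ofReal s * P < ⨆ x : ℝ, volume (Prod.mk x ⁻¹' S) := by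
      rw [hP]
      calc ENNReal.ofReal s * P < 1 * P :=
            (ENNReal.mul_lt_mul_iff_left hP0 hPt).2 (by simpa using hs.2)
        _ = P := one_mul P
    obtain ⟨x, hx⟩ := lt_iSup_iff.1 h1
    exact ⟨x, (ENNReal.lt_div_iff_mul_lt (.inl hP0) (.inl hPt)).2 hx⟩
  have main : volume A / M + volume B / N ≤ volume (A + B) / (M + N) := by
    rw [layer hA hM, layer hB hN, ← hdiv _ hC]
    refine le_trans ?_ (setLIntegral_Ioo_meas_lt_le volume (hm _ hC))
    refine (le_lintegral_add _ _).trans (setLIntegral_mono' measurableSet_Ioo fun s hs => ?_)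
    refine (MeasurableSet.volume_add_volume_le_real
      (measurableSet_lt measurable_const (hm M hA)) (measurableSet_lt measurable_const (hm N hB))
      (hne hM0 hMt hM s hs) (hne hN0 hNt hN s hs)).trans (measure_mono ?_)
    rintro _ ⟨x, hx, y, hy, rfl⟩
    simp only [mem_ofPred_eq] at hx hy ⊢
    rw [ENNReal.lt_div_iff_mul_lt (.inl hM0) (.inl hMt)] at hx
    rw [ENNReal.lt_div_iff_mul_lt (.inl hN0) (.inl hNt)] at hy
    rw [ENNReal.lt_div_iff_mul_lt (.inl (by simp [hM0])) (.inl (by simp [hMt, hNt])), mul_add]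
    have nonempty : ∀ {S : Set (ℝ × ℝ)} {r : ℝ≥0∞} {z : ℝ}, r < volume (Prod.mk z ⁻¹' S) →
        (Prod.mk z ⁻¹' S).Nonempty := fun h => nonempty_of_measure_ne_zero (zero_le.trans_lt h).ne'
    calc ENNReal.ofReal s * M + ENNReal.ofReal s * N
        < volume (Prod.mk x ⁻¹' A) + volume (Prod.mk y ⁻¹' B) := ENNReal.add_lt_add hx hy
      _ ≤ volume (Prod.mk x ⁻¹' A + Prod.mk y ⁻¹' B) :=
          MeasurableSet.volume_add_volume_le_real
            (hA.preimage (Continuous.prodMk_right x)).measurableSet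
            (hB.preimage (Continuous.prodMk_right y)).measurableSet (nonempty hx) (nonempty hy)
      _ ≤ volume (Prod.mk (x + y) ⁻¹' (A + B)) := by
          refine measure_mono ?_
          rintro _ ⟨u, hu, v, hv, rfl⟩
          exact ⟨(x, u), hu, (y, v), hv, rfl⟩
  have hAf : volume A ≠ ⊤ := hAb.measure_lt_top.ne
  have hBf : volume B ≠ ⊤ := hBb.measure_lt_top.ne
  have hCf : volume (A + B) ≠ ⊤ := hCb.measure_lt_top.ne
  have hMN0 : M + N ≠ 0 := by simp [hM0]
  have mainR := ENNReal.toReal_mono (ENNReal.div_ne_top hCf hMN0) main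
  rw [ENNReal.toReal_add (ENNReal.div_ne_top hAf hM0) (ENNReal.div_ne_top hBf hN0),
    ENNReal.toReal_div, ENNReal.toReal_div, ENNReal.toReal_div, ENNReal.toReal_add hMt hNt] at mainR
  have hMp : 0 < M.toReal := ENNReal.toReal_pos hM0 hMt
  have hNp : 0 < N.toReal := ENNReal.toReal_pos hN0 hNt
  have sA := Real.sq_sqrt (x := (volume A).toReal) ENNReal.toReal_nonneg
  have sB := Real.sq_sqrt (x := (volume B).toReal) ENNReal.toReal_nonneg
  rw [← sA, ← sB, le_div_iff₀ (by positivity)] at mainR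
  refine le_trans ?_ mainR
  set α := √(volume A).toReal
  set β := √(volume B).toReal
  set m := M.toReal
  set n := N.toReal
  have : (α ^ 2 / m + β ^ 2 / n) * (m + n) - (α + β) ^ 2 = (α * n - β * m) ^ 2 / (m * n) := by
    field_simp
    ring
  have h0 : 0 ≤ (α * n - β * m) ^ 2 / (m * n) := by positivity
  linarith

/-- The isoperimetric inequality, as a growth estimate for the parallel sets of a bounded
open set. -/
theorem IsOpen.volume_add_le_volume_thickening {A : Set ℂ} (hA : IsOpen A)
    (hAb : Bornology.IsBounded A) {ε : ℝ} (hε : 0 < ε) :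
    volume A + ENNReal.ofReal ε * (2 * (ENNReal.ofReal Real.pi * volume A) ^ ((1 : ℝ) / 2)) ≤
      volume (thickening ε A) := by
  rcases A.eq_empty_or_nonempty with rfl | hA0
  · simp
  let e : ℂ ≃L[ℝ] ℝ × ℝ := Complex.equivRealProdCLM
  have hvol : ∀ S : Set ℂ, IsOpen S → volume (e '' S) = volume S := by
    intro S hS
    have h := Complex.volume_preserving_equiv_real_prod.symm.measure_preimage
      hS.measurableSet.nullMeasurableSet
    rw [← h]
    congr 1
    exact e.toEquiv.image_eq_preimage_symm S
  have hB := isOpen_ball (x := (0 : ℂ)) (ε := ε)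
  have h := (e.isOpenMap A hA).sq_sqrt_volume_add_sqrt_volume_le
    (e.isOpenMap _ hB) (hA0.image _) ((nonempty_ball.2 hε).image _)
    (e.lipschitz.isBounded_image hAb) (e.lipschitz.isBounded_image isBounded_ball)
  have hadd : e '' A + e '' ball 0 ε = e '' (thickening ε A) := by
    rw [← Set.image_add e, add_ball_zero]
  have hTf : volume (thickening ε A) ≠ ⊤ := hAb.thickening.measure_lt_top.ne
  have hAf : volume A ≠ ⊤ := hAb.measure_lt_top.ne
  rw [hadd, hvol A hA, hvol _ hB, hvol _ isOpen_thickening, Complex.volume_ball] at h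
  have hsB : √(ENNReal.ofReal ε ^ 2 * (NNReal.pi : ℝ≥0∞)).toReal = ε * √Real.pi := by
    rw [ENNReal.toReal_mul, ENNReal.toReal_pow, ENNReal.toReal_ofReal hε.le,
      Real.sqrt_mul (by positivity), Real.sqrt_sq hε.le]
    rfl
  rw [hsB] at h
  have hpow : (ENNReal.ofReal Real.pi * volume A) ^ ((1 : ℝ) / 2) =
      ENNReal.ofReal (√Real.pi * √(volume A).toReal) := by
    rw [← Real.sqrt_mul Real.pi_pos.le, Real.sqrt_eq_rpow,
      ← ENNReal.ofReal_rpow_of_nonneg (by positivity) (by norm_num),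
      ENNReal.ofReal_mul Real.pi_pos.le, ENNReal.ofReal_toReal hAf]
  rw [hpow, ← ENNReal.ofReal_toReal hAf, ← ENNReal.ofReal_toReal hTf,
    show (2 : ℝ≥0∞) = ENNReal.ofReal 2 by simp, ← ENNReal.ofReal_mul (by norm_num),
    ← ENNReal.ofReal_mul hε.le, ← ENNReal.ofReal_add ENNReal.toReal_nonneg (by positivity)]
  refine ENNReal.ofReal_le_ofReal ?_
  rw [ENNReal.toReal_ofReal ENNReal.toReal_nonneg]
  have sA := Real.sq_sqrt (x := (volume A).toReal) ENNReal.toReal_nonneg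
  nlinarith [sq_nonneg (ε * √Real.pi)]

end

/-- The line integral of `σ` along `c` over the open parameter interval `(0, T)`. -/
def curveIntegral₀ (σ : ℂ → ℝ≥0∞) (c : ℝ → ℂ) (T : ℝ) : ℝ≥0∞ :=
  ∫⁻ s in Ioo (0 : ℝ) T, σ (c s) * ‖deriv c s‖ₑ

theorem setLIntegral_ball_eq (σ : ℂ → ℝ≥0∞) (x : ℂ) (r : ℝ) :
    ∫⁻ y in ball x r, σ y = ∫⁻ h in ball (0 : ℂ) r, σ (x + h) := by
  rw [← lintegral_indicator measurableSet_ball, ← lintegral_indicator measurableSet_ball,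
    ← lintegral_add_left_eq_self _ x]
  refine lintegral_congr fun h => ?_
  simp [indicator, mem_ball, dist_eq_norm]

theorem lintegral_setLIntegral_ball {σ : ℂ → ℝ≥0∞} (hσ : Measurable σ) (r : ℝ) :
    ∫⁻ x, ∫⁻ y in ball x r, σ y = (∫⁻ x, σ x) * volume (ball (0 : ℂ) r) := by
  simp_rw [setLIntegral_ball_eq σ _ r]
  rw [lintegral_lintegral_swap (by fun_prop)]
  simp_rw [lintegral_add_right_eq_self]
  simp

theorem measurable_setLIntegral_ball {σ : ℂ → ℝ≥0∞} (hσ : Measurable σ) (r : ℝ) :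
    Measurable fun x => ∫⁻ y in ball x r, σ y := by
  simp_rw [setLIntegral_ball_eq σ _ r]
  exact Measurable.lintegral_prod_right' (f := fun q : ℂ × ℂ => σ (q.1 + q.2)) (by fun_prop)

/-- The average of `σ` over a disk of radius `r`, normalized by the area of the disk of
radius `δ`. -/
def diskAverage (σ : ℂ → ℝ≥0∞) (δ r : ℝ) (x : ℂ) : ℝ≥0∞ :=
  (∫⁻ y in ball x r, σ y) / volume (ball (0 : ℂ) δ)

theorem curveIntegral₀_diskAverage {σ : ℂ → ℝ≥0∞} (hσ : Measurable σ) (δ r : ℝ) {c : ℝ → ℂ}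
    (hc : Continuous c) (T : ℝ) :
    curveIntegral₀ (diskAverage σ δ r) c T =
      (∫⁻ h in ball (0 : ℂ) r, curveIntegral₀ σ (fun s => c s + h) T) /
        volume (ball (0 : ℂ) δ) := by
  have hd : Measurable (deriv c) := measurable_deriv c
  have hc' := hc.measurable
  simp only [curveIntegral₀, diskAverage, setLIntegral_ball_eq σ _ r, deriv_add_const]
  rw [lintegral_lintegral_swap (by fun_prop)]
  simp_rw [div_eq_mul_inv]
  rw [← lintegral_mul_const _ (Measurable.lintegral_prod_right'
    (f := fun q : ℝ × ℂ => σ (c q.1 + q.2) * ‖deriv c q.1‖ₑ) (by fun_prop))]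
  refine lintegral_congr fun s => ?_
  dsimp only
  rw [lintegral_mul_const _ (by fun_prop)]
  ring

/-- The curve obtained by following `c` up to time `T`, then moving with velocity `w`. -/
def extendCurve (c : ℝ → ℂ) (T : ℝ) (w : ℂ) (s : ℝ) : ℂ :=
  c (min s T) + max (s - T) 0 • w

theorem lipschitzWith_extendCurve {C : NNReal} {c : ℝ → ℂ} (hc : LipschitzWith C c) (T : ℝ)
    (w : ℂ) : ∃ C', LipschitzWith C' (extendCurve c T w) := by
  have h1 : LipschitzWith 1 fun s : ℝ => max (s - T) 0 := by
    simpa using ((LipschitzWith.id.sub (LipschitzWith.const T)).max_const 0)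
  have h2 : LipschitzWith 1 fun s : ℝ => min s T := LipschitzWith.id.min_const T
  have h3 : LipschitzWith ‖w‖₊ fun r : ℝ => r • w :=
    LipschitzWith.of_dist_le_mul fun a b => by
      rw [dist_eq_norm, ← sub_smul, norm_smul, mul_comm, dist_eq_norm]
      simp
  exact ⟨_, (hc.comp h2).add (h3.comp h1)⟩

theorem curveIntegral₀_extendCurve_le (τ : ℂ → ℝ≥0∞) (c : ℝ → ℂ) (T : ℝ) (w : ℂ)
    {N : ℝ≥0∞} (hN : ∀ r ∈ Ioo (0 : ℝ) 1, τ (c T + r • w) ≤ N) :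
    curveIntegral₀ τ (extendCurve c T w) (T + 1) ≤ curveIntegral₀ τ c T + ‖w‖ₑ * N := by
  have hsub : Ioo (0 : ℝ) (T + 1) ⊆ Ioc 0 T ∪ Ioo T (T + 1) := by
    intro s hs
    rcases le_or_gt s T with h | h
    · exact .inl ⟨hs.1, h⟩
    · exact .inr ⟨h, hs.2⟩
  refine (lintegral_mono_set hsub).trans ((lintegral_union_le _ _ _).trans (add_le_add ?_ ?_))
  · rw [← restrict_Ioo_eq_restrict_Ioc]
    refine (setLIntegral_congr_fun measurableSet_Ioo fun s hs => ?_).le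
    have he : extendCurve c T w =ᶠ[nhds s] c := by
      filter_upwards [Iio_mem_nhds hs.2] with r hr
      have hr' : r < T := hr
      simp [extendCurve, min_eq_left hr'.le, max_eq_right (sub_nonpos.2 hr'.le)]
    simp only [he.deriv_eq, he.eq_of_nhds]
  · calc ∫⁻ s in Ioo T (T + 1), τ (extendCurve c T w s) * ‖deriv (extendCurve c T w) s‖ₑ
        ≤ ∫⁻ s in Ioo T (T + 1), ‖w‖ₑ * N := by
          refine setLIntegral_mono' measurableSet_Ioo fun s hs => ?_
          have he : extendCurve c T w =ᶠ[nhds s] fun r => c T + (r - T) • w := by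
            filter_upwards [Ioi_mem_nhds hs.1] with r hr
            have hr' : T < r := hr
            simp [extendCurve, min_eq_right hr'.le, max_eq_left (sub_nonneg.2 hr'.le)]
          have hd : HasDerivAt (fun r : ℝ => c T + (r - T) • w) w s := by
            simpa using (((hasDerivAt_id s).sub_const T).smul_const w).const_add (c T)
          rw [he.deriv_eq, he.eq_of_nhds, hd.deriv, mul_comm]
          gcongr
          exact hN _ ⟨by linarith [hs.1], by linarith [hs.2]⟩
      _ = ‖w‖ₑ * N := by simp

/-- The distance to `K` in the conformal metric `τ |dz|`. -/
def weightedDist (τ : ℂ → ℝ≥0∞) (K : Set ℂ) (x : ℂ) : ℝ≥0∞ :=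
  ⨅ (c : ℝ → ℂ) (T : ℝ) (_ : (∃ C, LipschitzWith C c) ∧ 0 < T ∧ c 0 ∈ K ∧ c T = x),
    curveIntegral₀ τ c T

theorem weightedDist_eq_zero (τ : ℂ → ℝ≥0∞) {K : Set ℂ} {x : ℂ} (hx : x ∈ K) :
    weightedDist τ K x = 0 := by
  refine le_antisymm ?_ zero_le
  refine (iInf_le_of_le (fun _ => x) (iInf_le_of_le 1 (iInf_le_of_le
    ⟨⟨0, LipschitzWith.const x⟩, one_pos, hx, rfl⟩ ?_)))
  simp [curveIntegral₀]

theorem weightedDist_le_add {τ : ℂ → ℝ≥0∞} {K : Set ℂ} {x y : ℂ} {N : ℝ≥0∞}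
    (hN : ∀ z ∈ segment ℝ x y, τ z ≤ N) :
    weightedDist τ K y ≤ weightedDist τ K x + ‖y - x‖ₑ * N := by
  simp only [weightedDist, ENNReal.iInf_add]
  refine le_iInf fun c => le_iInf fun T => le_iInf fun ⟨⟨C, hC⟩, hT, h0, hx⟩ => ?_
  refine iInf_le_of_le (extendCurve c T (y - x)) (iInf_le_of_le (T + 1) (iInf_le_of_le
    ⟨lipschitzWith_extendCurve hC T _, by linarith, ?_, ?_⟩ ?_))
  · simpa [extendCurve, min_eq_left hT.le, max_eq_right (neg_nonpos.2 hT.le)] using h0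
  · simp [extendCurve, hx]
  · refine curveIntegral₀_extendCurve_le τ c T _ fun r hr => hN _ ?_
    rw [hx, segment_eq_image']
    exact ⟨r, ⟨hr.1.le, hr.2.le⟩, rfl⟩

theorem diskAverage_le_of_dist_lt (σ : ℂ → ℝ≥0∞) {δ ε : ℝ} {x z : ℂ} (h : dist z x < ε) :
    diskAverage σ δ δ z ≤ diskAverage σ δ (δ + ε) x := by
  refine ENNReal.div_le_div_right (lintegral_mono_set ?_) _
  exact ball_subset_ball' (by linarith)

theorem one_le_weightedDist_diskAverage {K U V : Set ℂ} {δ : ℝ} (hδ : 0 < δ)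
    (hU : thickening δ K ⊆ U) {σ : ℂ → ℝ≥0∞} (hσ : Measurable σ)
    (hadm : ∀ (C : NNReal) (c : ℝ → ℂ) (T : ℝ), LipschitzWith C c → 0 < T → c 0 ∈ U → c T ∉ V →
      1 ≤ curveIntegral₀ σ c T) {x : ℂ} (hx : x ∉ thickening δ V) :
    1 ≤ weightedDist (diskAverage σ δ δ) K x := by
  have hW0 : volume (ball (0 : ℂ) δ) ≠ 0 := (measure_ball_pos _ _ hδ).ne'
  have hWt : volume (ball (0 : ℂ) δ) ≠ ⊤ := measure_ball_lt_top.ne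
  refine le_iInf fun c => le_iInf fun T => le_iInf fun ⟨⟨C, hC⟩, hT, h0, hxT⟩ => ?_
  rw [curveIntegral₀_diskAverage hσ _ _ hC.continuous,
    ENNReal.le_div_iff_mul_le (.inl hW0) (.inl hWt), one_mul, ← setLIntegral_one]
  refine setLIntegral_mono' measurableSet_ball fun h hh => ?_
  rw [mem_ball_zero_iff] at hh
  refine hadm C _ T (by simpa using hC.add (LipschitzWith.const h)) hT (hU ?_) fun hV => hx ?_
  · exact mem_thickening_iff.2 ⟨c 0, h0, by simpa [dist_eq_norm] using hh⟩
  · exact mem_thickening_iff.2 ⟨_, hV, by simpa [dist_eq_norm, hxT] using hh⟩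

/-- If every Lipschitz curve from the `δ`-neighbourhood of `K` to the complement of the
bounded set `V` has `σ`-length at least one, the total mass of `σ` is at least
`2 √(π |K|)`. -/
theorem two_mul_sqrt_pi_mul_volume_le_lintegral {K U V : Set ℂ}
    {δ : ℝ} (hδ : 0 < δ) (hU : thickening δ K ⊆ U) (hV : Bornology.IsBounded V)
    {σ : ℂ → ℝ≥0∞} (hσ : Measurable σ)
    (hadm : ∀ (C : NNReal) (c : ℝ → ℂ) (T : ℝ), LipschitzWith C c → 0 < T → c 0 ∈ U → c T ∉ V →
      1 ≤ curveIntegral₀ σ c T) :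
    2 * (ENNReal.ofReal Real.pi * volume K) ^ ((1 : ℝ) / 2) ≤ ∫⁻ z, σ z := by
  rcases eq_or_ne (∫⁻ z, σ z) ⊤ with htop | hfin
  · rw [htop]
    exact le_top
  have hW0 : volume (ball (0 : ℂ) δ) ≠ 0 := (measure_ball_pos _ _ hδ).ne'
  have hWt : volume (ball (0 : ℂ) δ) ≠ ⊤ := measure_ball_lt_top.ne
  set u := weightedDist (diskAverage σ δ δ) K with hu
  set v : ℂ → ℝ≥0∞ := fun x => 1 - u x with hv
  have hvle : ∀ {x y : ℂ} {N : ℝ≥0∞}, (∀ z ∈ segment ℝ x y, diskAverage σ δ δ z ≤ N) →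
      v x ≤ v y + ‖y - x‖ₑ * N := by
    intro x y N hN
    rw [tsub_le_iff_right]
    calc (1 : ℝ≥0∞) ≤ v y + u y := le_tsub_add
      _ ≤ v y + (u x + ‖y - x‖ₑ * N) := by gcongr; exact weightedDist_le_add hN
      _ = v y + ‖y - x‖ₑ * N + u x := by ring
  have hopen : ∀ r : ℝ≥0∞, IsOpen {x | r < v x} := by
    intro r
    rw [isOpen_iff_mem_nhds]
    intro x hx
    set N := (∫⁻ z, σ z) / volume (ball (0 : ℂ) δ)
    have hNt : N ≠ ⊤ := ENNReal.div_ne_top hfin hW0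
    have hlim : Filter.Tendsto (fun y : ℂ => ‖y - x‖ₑ * N) (nhds x) (nhds 0) := by
      have h1 : Continuous fun y : ℂ => ‖y - x‖ₑ := by fun_prop
      have := ENNReal.Tendsto.mul_const (h1.tendsto x) (.inr hNt)
      simpa using this
    filter_upwards [hlim.eventually_lt_const (tsub_pos_of_lt hx)] with y hy
    by_contra hyr
    have h2 : v x ≤ v y + ‖y - x‖ₑ * N :=
      hvle fun z _ => ENNReal.div_le_div_right (setLIntegral_le_lintegral _ _) _
    have hrt : r ≠ ⊤ := (lt_of_lt_of_le hx le_top).ne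
    have h3 : v x < r + (v x - r) := h2.trans_lt
      ((add_le_add_left (not_lt.1 hyr) _).trans_lt (ENNReal.add_lt_add_left hrt hy))
    rw [add_tsub_cancel_of_le (le_of_lt hx)] at h3
    exact lt_irrefl _ h3
  have hvm : Measurable v := measurable_of_Ioi fun r => (hopen r).measurableSet
  have hv1 : ∀ x, v x ≤ 1 := fun x => tsub_le_self
  have hvK : ∀ x ∈ K, v x = 1 := fun x hx => by
    simp [hv, hu, weightedDist_eq_zero _ hx]
  have hvV : ∀ x, v x ≠ 0 → x ∈ thickening δ V := fun x hx => by
    by_contra h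
    exact hx (tsub_eq_zero_of_le (one_le_weightedDist_diskAverage hδ hU hσ hadm h))
  have hvfin : ∫⁻ x, v x ≠ ⊤ := by
    refine ne_top_of_le_ne_top (b := volume (thickening δ V)) hV.thickening.measure_lt_top.ne ?_
    rw [← lintegral_indicator_one isOpen_thickening.measurableSet]
    refine lintegral_mono fun x => ?_
    by_cases hx : x ∈ thickening δ V
    · simpa [hx] using hv1 x
    · simp [not_not.1 (mt (hvV x) hx)]
  set I := 2 * (ENNReal.ofReal Real.pi * volume K) ^ ((1 : ℝ) / 2) with hI
  have hstep : ∀ ε : ℝ, 0 < ε →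
      I ≤ (∫⁻ x, σ x) * ENNReal.ofReal (((δ + ε) / δ) ^ 2) := by
    intro ε hε
    set m := diskAverage σ δ (δ + ε) with hm
    have hmm : Measurable m := (measurable_setLIntegral_ball hσ _).div_const _
    have hmint : ∫⁻ x, m x = (∫⁻ x, σ x) * ENNReal.ofReal (((δ + ε) / δ) ^ 2) := by
      simp only [hm, diskAverage, div_eq_mul_inv]
      rw [lintegral_mul_const _ (measurable_setLIntegral_ball hσ _), lintegral_setLIntegral_ball hσ,
        mul_assoc]
      congr 1
      rw [Complex.volume_ball, Complex.volume_ball, ← div_eq_mul_inv,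
        ENNReal.mul_div_mul_right _ _ (by simp [NNReal.pi_ne_zero]) (by simp),
        ← ENNReal.ofReal_pow (by positivity), ← ENNReal.ofReal_pow (by positivity),
        ← ENNReal.ofReal_div_of_pos (by positivity), ← div_eq_mul_inv, div_pow]
    rw [← hmint]
    have hsum : (∫⁻ x, v x) + ENNReal.ofReal ε * I ≤
        (∫⁻ x, v x) + ENNReal.ofReal ε * ∫⁻ x, m x := by
      calc (∫⁻ x, v x) + ENNReal.ofReal ε * I
          = ∫⁻ s in Ioo (0 : ℝ) 1,
              (volume {x | ENNReal.ofReal s < v x} + ENNReal.ofReal ε * I) := by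
            rw [lintegral_add_right _ measurable_const,
              ← lintegral_eq_setLIntegral_Ioo_meas_lt volume hvm hv1]
            simp
        _ ≤ ∫⁻ s in Ioo (0 : ℝ) 1,
              volume {x | ENNReal.ofReal s < v x + ENNReal.ofReal ε * m x} := by
            refine setLIntegral_mono' measurableSet_Ioo fun s hs => ?_
            have hKs : volume K ≤ volume {x | ENNReal.ofReal s < v x} :=
              measure_mono fun x hx => by simpa [hvK x hx] using hs.2
            have hb : Bornology.IsBounded {x | ENNReal.ofReal s < v x} :=
              hV.thickening.subset fun x hx => hvV x (zero_le.trans_lt hx).ne'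
            calc volume {x | ENNReal.ofReal s < v x} + ENNReal.ofReal ε * I
                ≤ volume {x | ENNReal.ofReal s < v x} + ENNReal.ofReal ε *
                  (2 * (ENNReal.ofReal Real.pi *
                    volume {x | ENNReal.ofReal s < v x}) ^ ((1 : ℝ) / 2)) := by
                  rw [hI]
                  gcongr
              _ ≤ volume (thickening ε {x | ENNReal.ofReal s < v x}) :=
                  (hopen _).volume_add_le_volume_thickening hb hε
              _ ≤ _ := by
                  refine measure_mono fun x hx => ?_
                  obtain ⟨y, hy, hxy⟩ := mem_thickening_iff.1 hx
                  refine lt_of_lt_of_le hy ((hvle (y := x) (N := m x) fun z hz => ?_).trans ?_)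
                  · refine diskAverage_le_of_dist_lt σ ?_
                    exact (convex_ball x ε).segment_subset (by rwa [mem_ball, dist_comm])
                      (mem_ball_self hε) hz
                  · gcongr
                    rw [← edist_eq_enorm_sub, edist_dist]
                    exact ENNReal.ofReal_le_ofReal hxy.le
        _ ≤ ∫⁻ x, (v x + ENNReal.ofReal ε * m x) :=
            setLIntegral_Ioo_meas_lt_le volume (hvm.add (hmm.const_mul _))
        _ = _ := by rw [lintegral_add_left hvm, lintegral_const_mul _ hmm]
    exact (ENNReal.mul_le_mul_iff_right (by simpa using hε) ENNReal.ofReal_ne_top).1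
      ((ENNReal.add_le_add_iff_left hvfin).1 hsum)
  have hlim : Filter.Tendsto (fun ε : ℝ => (∫⁻ x, σ x) * ENNReal.ofReal (((δ + ε) / δ) ^ 2))
      (nhdsWithin 0 (Ioi 0)) (nhds (∫⁻ x, σ x)) := by
    have h1 : Continuous fun ε : ℝ => ENNReal.ofReal (((δ + ε) / δ) ^ 2) :=
      ENNReal.continuous_ofReal.comp (by fun_prop)
    have h2 := ENNReal.Tendsto.const_mul (a := ∫⁻ x, σ x) (h1.tendsto 0) (.inr hfin)
    simp only [add_zero, div_self hδ.ne', one_pow, ENNReal.ofReal_one, mul_one] at h2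
    exact h2.mono_left nhdsWithin_le_nhds
  exact ge_of_tendsto hlim (Filter.eventually_of_mem self_mem_nhdsWithin hstep)

/-- The extremal density `1 / (|z - z₀| log (b / a))` of the closed annulus with radii `a`, `b`. -/
def ringDensity (z₀ : ℂ) (a b : ℝ) (z : ℂ) : ℝ≥0∞ :=
  {w : ℂ | ‖w - z₀‖ ∈ Icc a b}.indicator
    (fun w => ENNReal.ofReal (‖w - z₀‖ * Real.log (b / a))⁻¹) z

theorem measurable_ringDensity (z₀ : ℂ) (a b : ℝ) : Measurable (ringDensity z₀ a b) :=
  Measurable.indicator (by fun_prop)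
    (measurableSet_Icc.preimage (by fun_prop : Measurable fun w : ℂ => ‖w - z₀‖))

theorem Real.lipschitzOnWith_log_Ici {a : ℝ} (ha : 0 < a) :
    LipschitzOnWith (Real.toNNReal a⁻¹) Real.log (Ici a) := by
  refine (convex_Ici a).lipschitzOnWith_of_nnnorm_deriv_le (fun x hx => ?_) (fun x hx => ?_)
  · exact Real.differentiableAt_log (ha.trans_le hx).ne'
  · rw [Real.deriv_log, ← NNReal.coe_le_coe, coe_nnnorm, Real.norm_eq_abs,
      abs_of_pos (inv_pos.2 (ha.trans_le hx)), Real.coe_toNNReal _ (inv_pos.2 ha).le]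
    exact inv_anti₀ ha hx

theorem enorm_deriv_log_norm_le {γ : ℝ → ℂ} {z₀ : ℂ} {s : ℝ} (hγ : DifferentiableAt ℝ γ s)
    (h0 : 0 < ‖γ s - z₀‖) :
    ‖deriv (fun r => Real.log ‖γ r - z₀‖) s‖ₑ ≤ ENNReal.ofReal ‖γ s - z₀‖⁻¹ * ‖deriv γ s‖ₑ := by
  have h1 : HasFDerivAt (fun w : ℂ => ‖w‖) (fderiv ℝ (fun w : ℂ => ‖w‖) (γ s - z₀)) (γ s - z₀) :=
    (DifferentiableAt.norm ℝ differentiableAt_id (norm_pos_iff.1 h0)).hasFDerivAt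
  have h2 : ‖fderiv ℝ (fun w : ℂ => ‖w‖) (γ s - z₀)‖ ≤ 1 := by
    simpa using norm_fderiv_le_of_lipschitz ℝ (x₀ := γ s - z₀) (lipschitzWith_one_norm (E := ℂ))
  have h3 := (h1.comp_hasDerivAt s (hγ.hasDerivAt.sub_const z₀)).log h0.ne'
  have h4 : deriv (fun r => Real.log ‖γ r - z₀‖) s = _ := h3.deriv
  rw [h4, ← ofReal_norm, ← ofReal_norm, ← ENNReal.ofReal_mul (by positivity)]
  refine ENNReal.ofReal_le_ofReal ?_
  rw [norm_div, Function.comp_apply, norm_norm, div_eq_inv_mul]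
  gcongr
  simpa using (fderiv ℝ (fun w : ℂ => ‖w‖) (γ s - z₀)).le_of_opNorm_le h2 (deriv γ s)

theorem one_le_lineIntegral_ringDensity {z₀ : ℂ} {a b : ℝ} (ha : 0 < a) (hab : a < b)
    {γ : ℝ → ℂ} (hγ : ∀ s ∈ Icc (0 : ℝ) 1, ‖γ s - z₀‖ ∈ Icc a b) (h0 : ‖γ 0 - z₀‖ = a)
    (h1 : ‖γ 1 - z₀‖ = b) : 1 ≤ lineIntegral (ringDensity z₀ a b) γ := by
  rw [lineIntegral]
  split_ifs with hC
  swap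
  · exact le_top
  obtain ⟨C, hC⟩ := hC
  have hL : 0 < Real.log (b / a) := Real.log_pos ((one_lt_div ha).2 hab)
  set r : ℝ → ℝ := fun s => Real.log ‖γ s - z₀‖ with hr
  have hrL : LipschitzOnWith (Real.toNNReal a⁻¹ * (1 * C)) r (Icc 0 1) := by
    have hn : LipschitzWith 1 fun w : ℂ => ‖w - z₀‖ := by
      simpa [Function.comp_def] using
        lipschitzWith_one_norm.comp (LipschitzWith.id.sub (LipschitzWith.const z₀))
    exact (Real.lipschitzOnWith_log_Ici ha).comp (hn.comp_lipschitzOnWith hC)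
      fun s hs => (hγ s hs).1
  have hFTC : ∫ s in (0 : ℝ)..1, deriv r s = Real.log (b / a) := by
    rw [AbsolutelyContinuousOnInterval.integral_deriv_eq_sub
      (LipschitzOnWith.absolutelyContinuousOnInterval (by rwa [uIcc_of_le zero_le_one]))]
    simp only [hr, h0, h1]
    rw [Real.log_div (ha.trans hab).ne' ha.ne']
  have hle : ENNReal.ofReal (Real.log (b / a)) ≤
      ∫⁻ s in Icc (0 : ℝ) 1, ENNReal.ofReal (Real.log (b / a)) *
        (ringDensity z₀ a b (γ s) * (‖deriv γ s‖₊ : ℝ≥0∞)) := by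
    calc ENNReal.ofReal (Real.log (b / a)) = ‖∫ s in Ioc (0 : ℝ) 1, deriv r s‖ₑ := by
          rw [← intervalIntegral.integral_of_le zero_le_one, hFTC,
            Real.enorm_of_nonneg hL.le]
      _ ≤ ∫⁻ s in Ioc (0 : ℝ) 1, ‖deriv r s‖ₑ := enorm_integral_le_lintegral_enorm _
      _ = ∫⁻ s in Ioo (0 : ℝ) 1, ‖deriv r s‖ₑ := by rw [restrict_Ioo_eq_restrict_Ioc]
      _ ≤ ∫⁻ s in Ioo (0 : ℝ) 1, ENNReal.ofReal (Real.log (b / a)) *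
            (ringDensity z₀ a b (γ s) * (‖deriv γ s‖₊ : ℝ≥0∞)) := by
          refine setLIntegral_mono_ae' measurableSet_Ioo ?_
          filter_upwards [(ae_restrict_iff' measurableSet_Icc).1
            (hC.ae_differentiableWithinAt_real measurableSet_Icc)] with s hs hs01
          have hs' : s ∈ Icc (0 : ℝ) 1 := Ioo_subset_Icc_self hs01
          have hpos : 0 < ‖γ s - z₀‖ := ha.trans_le (hγ s hs').1
          refine (enorm_deriv_log_norm_le
            ((hs hs').differentiableAt (Icc_mem_nhds hs01.1 hs01.2)) hpos).trans ?_
          have hmem : γ s ∈ {w : ℂ | ‖w - z₀‖ ∈ Icc a b} := hγ s hs'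
          rw [ringDensity, indicator_of_mem hmem, ← mul_assoc, ← ENNReal.ofReal_mul hL.le,
            mul_inv, mul_left_comm, mul_inv_cancel₀ hL.ne', mul_one, enorm_eq_nnnorm]
      _ ≤ _ := lintegral_mono_set Ioo_subset_Icc_self
  rw [lintegral_const_mul' _ _ ENNReal.ofReal_ne_top] at hle
  rw [← ENNReal.mul_le_mul_iff_right (ENNReal.ofReal_pos.2 hL).ne' ENNReal.ofReal_ne_top, mul_one]
  exact hle

theorem lintegral_eq_polar {G : ℂ → ℝ≥0∞} (hG : Measurable G) (z₀ : ℂ) :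
    ∫⁻ z, G z = ∫⁻ τ in Ioi (0 : ℝ), ENNReal.ofReal τ *
      ∫⁻ θ in Icc (0 : ℝ) (2 * Real.pi), G (z₀ + (τ : ℂ) * Complex.exp ((θ : ℂ) * Complex.I)) := by
  rw [← lintegral_add_left_eq_self G z₀,
    ← Complex.lintegral_comp_polarCoord_symm (fun z => G (z₀ + z)), polarCoord_target,
    Measure.volume_eq_prod, ← Measure.prod_restrict, lintegral_prod _ (by
      simp only [Complex.polarCoord_symm_apply, smul_eq_mul]
      fun_prop)]
  refine lintegral_congr fun τ => ?_
  simp only [Complex.polarCoord_symm_apply, smul_eq_mul]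
  rw [lintegral_const_mul _ (by fun_prop)]
  congr 1
  have hexp : ∀ θ : ℝ, (Real.cos θ : ℂ) + Real.sin θ * Complex.I =
      Complex.exp ((θ : ℂ) * Complex.I) := fun θ => by
    rw [Complex.exp_mul_I]
    push_cast
    rfl
  simp only [hexp]
  have h1 := isAddFundamentalDomain_Ioc Real.two_pi_pos (-Real.pi)
  have h2 := isAddFundamentalDomain_Ioc Real.two_pi_pos 0
  rw [restrict_Ioo_eq_restrict_Ioc, ← restrict_Ioc_eq_restrict_Icc]
  have h3 := h1.setLIntegral_eq h2
    (fun θ : ℝ => G (z₀ + (τ : ℂ) * Complex.exp ((θ : ℂ) * Complex.I))) ?_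
  · rw [show -Real.pi + 2 * Real.pi = Real.pi by ring, zero_add] at h3
    exact h3
  · rintro ⟨_, n, rfl⟩ θ
    have hper : Function.Periodic (fun θ : ℝ => Complex.exp ((θ : ℂ) * Complex.I))
        (2 * Real.pi) := fun θ => by
      push_cast
      exact Complex.exp_mul_I_periodic θ
    have hn : Complex.exp (((n • (2 * Real.pi) + θ : ℝ) : ℂ) * Complex.I) =
        Complex.exp ((θ : ℂ) * Complex.I) := by
      rw [add_comm]
      exact hper.zsmul n θ
    simp only [AddSubgroup.vadd_def, vadd_eq_add, hn]

theorem lintegral_mul_ringDensity_rpow {p : ℝ} (hp : 0 < p) {Q : ℂ → ℝ≥0∞} (hQ : Measurable Q)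
    (z₀ : ℂ) {a b : ℝ} (ha : 0 < a) (hab : a < b) :
    ∫⁻ z, Q z * ringDensity z₀ a b z ^ p =
      ENNReal.ofReal (2 * Real.pi) / ENNReal.ofReal (Real.log (b / a)) ^ p *
        ∫⁻ τ in Icc a b, ENNReal.ofReal (τ ^ (1 - p)) * circleMean Q z₀ τ := by
  have hL : 0 < Real.log (b / a) := Real.log_pos ((one_lt_div ha).2 hab)
  have hm := measurable_ringDensity z₀ a b
  rw [lintegral_eq_polar (by fun_prop) z₀, ← lintegral_const_mul' _ _ (by
    refine ENNReal.div_ne_top ENNReal.ofReal_ne_top ?_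
    simp [ENNReal.rpow_eq_zero_iff, hL, hp])]
  rw [← lintegral_indicator measurableSet_Ioi, ← lintegral_indicator measurableSet_Icc]
  refine lintegral_congr fun τ => ?_
  have hnorm : ∀ θ : ℝ, 0 < τ → ‖z₀ + (τ : ℂ) * Complex.exp ((θ : ℂ) * Complex.I) - z₀‖ = τ := by
    intro θ hτ
    simp [Complex.norm_exp_ofReal_mul_I, abs_of_pos hτ]
  by_cases hτ : τ ∈ Icc a b
  · have hτ0 : 0 < τ := ha.trans_le hτ.1
    rw [indicator_of_mem (show τ ∈ Ioi 0 from hτ0), indicator_of_mem hτ]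
    have hring : ∀ θ : ℝ, ringDensity z₀ a b (z₀ + (τ : ℂ) * Complex.exp ((θ : ℂ) * Complex.I)) =
        ENNReal.ofReal (τ * Real.log (b / a))⁻¹ := by
      intro θ
      rw [ringDensity, indicator_of_mem (by simpa only [mem_ofPred_eq, hnorm θ hτ0] using hτ),
        hnorm θ hτ0]
    simp only [hring]
    rw [lintegral_mul_const _ (by fun_prop), circleMean]
    set J := ∫⁻ θ in Icc (0 : ℝ) (2 * Real.pi),
      Q (z₀ + (τ : ℂ) * Complex.exp ((θ : ℂ) * Complex.I))
    have hpi0 : ENNReal.ofReal (2 * Real.pi) ≠ 0 := (ENNReal.ofReal_pos.2 Real.two_pi_pos).ne'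
    have e1 : ENNReal.ofReal τ * ENNReal.ofReal (τ * Real.log (b / a))⁻¹ ^ p =
        (ENNReal.ofReal (Real.log (b / a)) ^ p)⁻¹ * ENNReal.ofReal (τ ^ (1 - p)) := by
      rw [ENNReal.ofReal_rpow_of_nonneg (by positivity) hp.le,
        ENNReal.ofReal_rpow_of_nonneg hL.le hp.le,
        ← ENNReal.ofReal_inv_of_pos (by positivity), ← ENNReal.ofReal_mul hτ0.le,
        ← ENNReal.ofReal_mul (by positivity)]
      congr 1
      rw [Real.inv_rpow (by positivity), Real.mul_rpow hτ0.le hL.le, Real.rpow_sub hτ0,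
        Real.rpow_one]
      field_simp
    calc ENNReal.ofReal τ * (J * ENNReal.ofReal (τ * Real.log (b / a))⁻¹ ^ p)
        = (ENNReal.ofReal τ * ENNReal.ofReal (τ * Real.log (b / a))⁻¹ ^ p) * J := by ring
      _ = (ENNReal.ofReal (Real.log (b / a)) ^ p)⁻¹ * ENNReal.ofReal (τ ^ (1 - p)) *
            (ENNReal.ofReal (2 * Real.pi) * (J / ENNReal.ofReal (2 * Real.pi))) := by
          rw [e1, ENNReal.mul_div_cancel hpi0 ENNReal.ofReal_ne_top]
      _ = _ := by
          rw [div_eq_mul_inv (ENNReal.ofReal (2 * Real.pi))]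
          ring
  · rw [indicator_of_notMem hτ]
    by_cases hτ0 : τ ∈ Ioi (0 : ℝ)
    · rw [indicator_of_mem hτ0]
      have hring : ∀ θ : ℝ,
          ringDensity z₀ a b (z₀ + (τ : ℂ) * Complex.exp ((θ : ℂ) * Complex.I)) = 0 := by
        intro θ
        rw [ringDensity, indicator_of_notMem]
        simpa only [mem_ofPred_eq, hnorm θ hτ0] using hτ
      simp [hring, hp]
    · rw [indicator_of_notMem hτ0]

theorem closedBall_subset_of_lt_infDist_frontier {D : Set ℂ} {z₀ : ℂ} (hz₀ : z₀ ∈ D) {r : ℝ}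
    (hr : r < infDist z₀ (frontier D)) : closedBall z₀ r ⊆ D := by
  by_cases hD : D = univ
  · simp [hD]
  obtain ⟨y, hy, hyd⟩ := exists_mem_frontier_infDist_compl_eq_dist hz₀ hD
  intro w hw
  by_contra hwD
  have h1 : infDist z₀ Dᶜ ≤ dist z₀ w := infDist_le_dist_of_mem hwD
  have h2 : infDist z₀ (frontier D) ≤ dist z₀ y := infDist_le_dist_of_mem hy
  have h3 : dist z₀ w ≤ r := by simpa [dist_comm] using hw
  linarith

theorem IsHomeoOn.continuousOn_invFunOn {f : ℂ → ℂ} {D : Set ℂ} (hf : IsHomeoOn f D)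
    (hD : IsOpen D) : ContinuousOn (Function.invFunOn f D) (f '' D) := by
  rw [continuousOn_open_iff (hf.2.2 D Subset.rfl hD)]
  intro W hW
  have : f '' D ∩ Function.invFunOn f D ⁻¹' W = f '' (D ∩ W) := by
    ext w
    constructor
    · rintro ⟨hw, hwW⟩
      exact ⟨_, ⟨Function.invFunOn_mem hw, hwW⟩, Function.invFunOn_eq hw⟩
    · rintro ⟨z, ⟨hz, hzW⟩, rfl⟩
      refine ⟨mem_image_of_mem f hz, ?_⟩
      rwa [mem_preimage, hf.2.1.leftInvOn_invFunOn hz]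
  rw [this]
  exact hf.2.2 _ inter_subset_left (hD.inter hW)

/-- A path from the image of a disk to the outside of the image of a larger concentric disk
contains an arc which is the image of an arc crossing the closed annulus in between. -/
theorem IsHomeoOn.exists_crossing_arc {f : ℂ → ℂ} {D : Set ℂ} (hf : IsHomeoOn f D)
    (hD : IsOpen D) {z₀ : ℂ} {r R : ℝ} (hrR : r < R) (hR : closedBall z₀ R ⊆ D)
    {c : ℝ → ℂ} (hc : Continuous c) {S : ℝ} (hS : 0 < S) (hc0 : c 0 ∈ f '' ball z₀ r)
    (hcS : c S ∉ f '' ball z₀ R) :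
    ∃ a b : ℝ, 0 ≤ a ∧ a < b ∧ b ≤ S ∧ ∃ g : ℝ → ℂ, ContinuousOn g (Icc a b) ∧
      (∀ s ∈ Icc a b, f (g s) = c s ∧ ‖g s - z₀‖ ∈ Icc r R) ∧
      ‖g a - z₀‖ = r ∧ ‖g b - z₀‖ = R := by
  have hball : ball z₀ R ⊆ D := ball_subset_closedBall.trans hR
  have hVo : IsOpen (f '' ball z₀ R) := hf.2.2 _ hball isOpen_ball
  have hVc : closure (f '' ball z₀ R) ⊆ f '' closedBall z₀ R :=
    closure_minimal (image_mono ball_subset_closedBall)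
      ((isCompact_closedBall z₀ R).image_of_continuousOn (hf.1.mono hR)).isClosed
  obtain ⟨b, ⟨hbI, hbV⟩, hbmin⟩ := ((isCompact_Icc (a := (0 : ℝ)) (b := S)).inter_right
    (hVo.isClosed_compl.preimage hc)).exists_isLeast ⟨S, ⟨hS.le, le_rfl⟩, hcS⟩
  have hb0 : 0 < b := by
    refine hbI.1.lt_of_ne ?_
    rintro rfl
    exact hbV (image_mono (ball_subset_ball hrR.le) hc0)
  have hlt : ∀ s ∈ Ico 0 b, c s ∈ f '' ball z₀ R := fun s hs => by
    by_contra hsV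
    exact (hbmin ⟨⟨hs.1, hs.2.le.trans hbI.2⟩, hsV⟩).not_gt hs.2
  have hcl : ∀ s ∈ Icc 0 b, c s ∈ f '' closedBall z₀ R := by
    intro s hs
    refine hVc (map_mem_closure hc ?_ hlt)
    rwa [closure_Ico hb0.ne]
  set g : ℝ → ℂ := fun s => Function.invFunOn f D (c s) with hg
  have hinv : ∀ z ∈ D, Function.invFunOn f D (f z) = z := fun z hz =>
    hf.2.1.leftInvOn_invFunOn hz
  have hgc : ContinuousOn g (Icc 0 b) := (hf.continuousOn_invFunOn hD).comp hc.continuousOn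
    fun s hs => image_mono hR (hcl s hs)
  have hfg : ∀ s ∈ Icc 0 b, f (g s) = c s := fun s hs =>
    Function.invFunOn_eq (image_mono hR (hcl s hs))
  have hgR : ∀ s ∈ Icc 0 b, ‖g s - z₀‖ ≤ R := by
    intro s hs
    obtain ⟨z, hz, hzs⟩ := hcl s hs
    simp only [hg, ← hzs, hinv z (hR hz)]
    simpa [dist_eq_norm] using hz
  have hgb : ‖g b - z₀‖ = R := by
    refine (hgR b ⟨hb0.le, le_rfl⟩).antisymm (le_of_not_gt fun h => hbV ?_)
    exact ⟨g b, by simpa [dist_eq_norm] using h, hfg b ⟨hb0.le, le_rfl⟩⟩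
  have hg0 : ‖g 0 - z₀‖ < r := by
    obtain ⟨z, hz, hz0⟩ := hc0
    simp only [hg, ← hz0, hinv z (hball (ball_subset_ball hrR.le hz))]
    simpa [dist_eq_norm] using hz
  have hh : ContinuousOn (fun s => ‖g s - z₀‖) (Icc 0 b) := (hgc.sub continuousOn_const).norm
  obtain ⟨a, ⟨haI, har⟩, hamax⟩ := (isCompact_Icc.of_isClosed_subset
    (hh.preimage_isClosed_of_isClosed isClosed_Icc (isClosed_Iic (a := r)))
    inter_subset_left).exists_isGreatest ⟨0, ⟨le_rfl, hb0.le⟩, hg0.le⟩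
  simp only [mem_preimage, mem_Iic] at har
  have hab : a < b := haI.2.lt_of_ne (by rintro rfl; linarith)
  have hIcc : Icc a b ⊆ Icc 0 b := Icc_subset_Icc_left haI.1
  have hga : ‖g a - z₀‖ = r := by
    obtain ⟨s, hs, hsr⟩ := intermediate_value_Icc hab.le (hh.mono hIcc)
      (show r ∈ Icc ‖g a - z₀‖ ‖g b - z₀‖ from ⟨har, by rw [hgb]; exact hrR.le⟩)
    have : s = a := (hamax ⟨hIcc hs, hsr.le⟩).antisymm hs.1
    rwa [this] at hsr
  refine ⟨a, b, haI.1, hab, hbI.2, g, hgc.mono hIcc, fun s hs =>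
    ⟨hfg s (hIcc hs), ?_, hgR s (hIcc hs)⟩, hga, hgb⟩
  rcases hs.1.eq_or_lt with rfl | has
  · exact hga.ge
  · by_contra! h
    exact (hamax ⟨hIcc hs, h.le⟩).not_gt has

/-- Reparametrizing an arc of a Lipschitz path on the unit interval does not change its line
integral. -/
theorem lineIntegral_eq_setLIntegral_of_eqOn {ρ : ℂ → ℝ≥0∞} {C : NNReal} {c γ : ℝ → ℂ}
    (hc : LipschitzWith C c) {a b : ℝ} (hab : a < b)
    (hγ : ∀ s ∈ Icc (0 : ℝ) 1, γ s = c (a + (b - a) * s)) :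
    lineIntegral ρ γ = ∫⁻ s in Ioo a b, ρ (c s) * ‖deriv c s‖ₑ := by
  have hba : 0 < b - a := sub_pos.2 hab
  have hlip : ∃ K : NNReal, LipschitzOnWith K γ (Icc 0 1) := by
    refine ⟨C * Real.toNNReal (b - a), LipschitzOnWith.of_dist_le_mul fun x hx y hy => ?_⟩
    rw [hγ x hx, hγ y hy]
    refine (hc.dist_le_mul _ _).trans (le_of_eq ?_)
    rw [NNReal.coe_mul, Real.coe_toNNReal _ hba.le, dist_add_left, Real.dist_eq, Real.dist_eq,
      ← mul_sub, abs_mul, abs_of_pos hba, mul_assoc]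
  rw [lineIntegral, if_pos hlip, ← restrict_Ioo_eq_restrict_Icc]
  have himg : (fun s : ℝ => a + (b - a) * s) '' Ioo 0 1 = Ioo a b := by
    ext x
    constructor
    · rintro ⟨s, ⟨h0, h1⟩, rfl⟩
      exact ⟨by simp only; nlinarith, by simp only; nlinarith⟩
    · rintro ⟨h0, h1⟩
      refine ⟨(x - a) / (b - a), ⟨div_pos (sub_pos.2 h0) hba,
        (div_lt_one hba).2 (by linarith)⟩, ?_⟩
      simp only
      field_simp
      ring
  have haff : ∀ s : ℝ, HasDerivAt (fun s : ℝ => a + (b - a) * s) (b - a) s := fun s => by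
    simpa using ((hasDerivAt_id s).const_mul (b - a)).const_add a
  rw [← himg, lintegral_image_eq_lintegral_abs_deriv_mul measurableSet_Ioo
    (fun s _ => (haff s).hasDerivWithinAt) (fun x _ y _ h => by
      simpa [hba.ne'] using h)]
  refine setLIntegral_congr_fun measurableSet_Ioo fun s hs => ?_
  have hev : γ =ᶠ[nhds s] fun s => c (a + (b - a) * s) := by
    filter_upwards [Icc_mem_nhds hs.1 hs.2] with x hx using hγ x hx
  have hd : deriv γ s = (b - a) • deriv c (a + (b - a) * s) := by
    rw [hev.deriv_eq, deriv_comp_mul_left (b - a) (fun u => c (a + u)), deriv_comp_const_add]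
  rw [hd, hγ s (Ioo_subset_Icc_self hs), ← enorm_eq_nnnorm, enorm_smul,
    Real.enorm_of_nonneg hba.le, abs_of_pos hba]
  ring

/-- The curves joining the boundary circles of the closed annulus with radii `r`, `R` inside it. -/
def crossingCurves (z₀ : ℂ) (r R : ℝ) : Set (ℝ → ℂ) :=
  {γ | ContinuousOn γ (Icc 0 1) ∧ (∀ s ∈ Icc (0 : ℝ) 1, ‖γ s - z₀‖ ∈ Icc r R) ∧
    ‖γ 0 - z₀‖ = r ∧ ‖γ 1 - z₀‖ = R}

theorem IsHomeoOn.two_mul_sqrt_pi_mul_volume_le {f : ℂ → ℂ} {D : Set ℂ} (hf : IsHomeoOn f D)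
    (hD : IsOpen D) {z₀ : ℂ} {t r R : ℝ} (htr : t < r) (hrR : r < R) (hR : closedBall z₀ R ⊆ D)
    {ρ : ℂ → ℝ≥0∞} (hρ : IsAdmissible ρ ((fun γ => f ∘ γ) '' crossingCurves z₀ r R)) :
    2 * (ENNReal.ofReal Real.pi * volume (f '' closedBall z₀ t)) ^ ((1 : ℝ) / 2) ≤
      ∫⁻ z in f '' closedBall z₀ R \ f '' closedBall z₀ t, ρ z := by
  have himg : ∀ s ≤ R, IsCompact (f '' closedBall z₀ s) := fun s hs =>
    (isCompact_closedBall z₀ s).image_of_continuousOn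
      (hf.1.mono ((closedBall_subset_closedBall hs).trans hR))
  have hK := himg t (htr.trans hrR).le
  have hm : MeasurableSet (f '' closedBall z₀ R \ f '' closedBall z₀ t) :=
    (himg R le_rfl).measurableSet.diff hK.measurableSet
  have hU : IsOpen (f '' ball z₀ r) :=
    hf.2.2 _ ((ball_subset_ball hrR.le).trans (ball_subset_closedBall.trans hR)) isOpen_ball
  obtain ⟨δ, hδ, hδU⟩ := hK.exists_thickening_subset_open hU
    (image_mono (closedBall_subset_ball htr))
  rw [← lintegral_indicator hm]
  refine two_mul_sqrt_pi_mul_volume_le_lintegral hδ hδU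
    ((himg R le_rfl).isBounded.subset (image_mono ball_subset_closedBall)) (hρ.1.indicator hm)
    fun C c S hc hS hc0 hcS => ?_
  obtain ⟨a, b, ha, hab, hbS, g, hgc, hg, hga, hgb⟩ :=
    hf.exists_crossing_arc hD hrR hR hc.continuous hS hc0 hcS
  have hmaps : ∀ s ∈ Icc (0 : ℝ) 1, a + (b - a) * s ∈ Icc a b := fun s hs =>
    ⟨by nlinarith [hs.1], by nlinarith [hs.2]⟩
  have hγ : (fun s => g (a + (b - a) * s)) ∈ crossingCurves z₀ r R :=
    ⟨hgc.comp (by fun_prop) hmaps, fun s hs => (hg _ (hmaps s hs)).2, by simpa using hga,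
      by simpa using hgb⟩
  calc 1 ≤ lineIntegral ρ (f ∘ fun s => g (a + (b - a) * s)) := hρ.2 _ ⟨_, hγ, rfl⟩
    _ = ∫⁻ s in Ioo a b, ρ (c s) * ‖deriv c s‖ₑ :=
        lineIntegral_eq_setLIntegral_of_eqOn hc hab fun s hs => (hg _ (hmaps s hs)).1
    _ = ∫⁻ s in Ioo a b, (f '' closedBall z₀ R \ f '' closedBall z₀ t).indicator ρ (c s) *
          ‖deriv c s‖ₑ := by
        refine setLIntegral_congr_fun measurableSet_Ioo fun s hs => ?_
        obtain ⟨hfs, hs1, hs2⟩ := hg s (Ioo_subset_Icc_self hs)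
        have hsR : g s ∈ closedBall z₀ R := by simpa [dist_eq_norm] using hs2
        have hmem : c s ∈ f '' closedBall z₀ R \ f '' closedBall z₀ t := by
          rw [← hfs]
          refine ⟨mem_image_of_mem f hsR, ?_⟩
          rintro ⟨z, hz, hzs⟩
          rw [← hf.2.1 (hR (closedBall_subset_closedBall (htr.trans hrR).le hz)) (hR hsR) hzs,
            ← dist_eq_norm] at hs1
          exact (hs1.trans hz).not_gt htr
        rw [indicator_of_mem hmem]
    _ ≤ _ := lintegral_mono_set (Ioo_subset_Ioo ha hbS)

theorem setLIntegral_rpow_le_measure_rpow_mul {α : Type*} [MeasurableSpace α] (μ : Measure α)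
    {p : ℝ} (hp : 1 < p) {ρ : α → ℝ≥0∞} (hρ : Measurable ρ) (A : Set α) :
    (∫⁻ z in A, ρ z ∂μ) ^ p ≤ μ A ^ (p - 1) * ∫⁻ z, ρ z ^ p ∂μ := by
  have hpq := Real.HolderConjugate.conjExponent hp
  have hp0 : 0 < p := by linarith
  have h := ENNReal.lintegral_mul_le_Lp_mul_Lq (μ.restrict A) hpq hρ.aemeasurable
    (aemeasurable_const (b := (1 : ℝ≥0∞)))
  simp only [Pi.mul_apply, mul_one, ENNReal.one_rpow, lintegral_const,
    Measure.restrict_apply_univ, one_mul] at h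
  calc (∫⁻ z in A, ρ z ∂μ) ^ p ≤ _ := ENNReal.rpow_le_rpow h hp0.le
    _ = μ A ^ (p - 1) * ∫⁻ z in A, ρ z ^ p ∂μ := by
        rw [ENNReal.mul_rpow_of_nonneg _ _ hp0.le, ← ENNReal.rpow_mul, ← ENNReal.rpow_mul,
          one_div_mul_cancel hp0.ne', ENNReal.rpow_one, mul_comm]
        congr 2
        rw [Real.conjExponent]
        field_simp
    _ ≤ _ := by
        gcongr
        exact Measure.restrict_le_self

theorem IsHomeoOn.rpow_two_mul_sqrt_pi_mul_volume_le_pModulus {f : ℂ → ℂ} {D : Set ℂ}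
    (hf : IsHomeoOn f D) (hD : IsOpen D) {z₀ : ℂ} {p t r R : ℝ} (hp : 1 < p) (ht : 0 < t)
    (htr : t < r) (hrR : r < R) (hR : closedBall z₀ R ⊆ D) :
    (2 * (ENNReal.ofReal Real.pi * volume (f '' closedBall z₀ t)) ^ ((1 : ℝ) / 2)) ^ p ≤
      (volume (f '' closedBall z₀ R) - volume (f '' closedBall z₀ t)) ^ (p - 1) *
        pModulus p ((fun γ => f ∘ γ) '' crossingCurves z₀ r R) := by
  have himg : ∀ s ≤ R, IsCompact (f '' closedBall z₀ s) := fun s hs =>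
    (isCompact_closedBall z₀ s).image_of_continuousOn
      (hf.1.mono ((closedBall_subset_closedBall hs).trans hR))
  have hK := himg t (htr.trans hrR).le
  have htop : (volume (f '' closedBall z₀ R) - volume (f '' closedBall z₀ t)) ^ (p - 1) ≠ ⊤ :=
    ENNReal.rpow_ne_top_of_nonneg (by linarith)
      (ENNReal.sub_ne_top (himg R le_rfl).measure_lt_top.ne)
  have hdiff := measure_sdiff (μ := volume)
    (image_mono (f := f) (closedBall_subset_closedBall (x := z₀) (htr.trans hrR).le))
    hK.measurableSet.nullMeasurableSet hK.measure_lt_top.ne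
  have hA0 : (volume (f '' closedBall z₀ R) - volume (f '' closedBall z₀ t)) ^ (p - 1) ≠ 0 := by
    have hsub : ball z₀ R \ closedBall z₀ t ⊆ D := fun z hz => hR (ball_subset_closedBall hz.1)
    have hne : (f '' (ball z₀ R \ closedBall z₀ t)).Nonempty := by
      refine Nonempty.image f ⟨z₀ + (r : ℂ), ?_, ?_⟩
      · simpa [dist_eq_norm, abs_of_pos (ht.trans htr)] using hrR
      · simpa [dist_eq_norm, abs_of_pos (ht.trans htr)] using htr
    have hpos : 0 < volume (f '' closedBall z₀ R \ f '' closedBall z₀ t) := by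
      refine ((hf.2.2 _ hsub (isOpen_ball.sdiff isClosed_closedBall)).measure_pos volume
        hne).trans_le (measure_mono ?_)
      rw [← (hf.2.1.mono hR).image_sdiff_subset
        (closedBall_subset_closedBall (htr.trans hrR).le)]
      exact image_mono (sdiff_subset_sdiff_left ball_subset_closedBall)
    rw [← hdiff]
    simp [ENNReal.rpow_eq_zero_iff, hpos.ne', hp.not_gt]
  rw [pModulus, ENNReal.mul_iInf_of_ne hA0 htop]
  refine le_iInf fun ρ => ?_
  rw [ENNReal.mul_iInf_of_ne hA0 htop]
  refine le_iInf fun hρ => ?_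
  refine (ENNReal.rpow_le_rpow (hf.two_mul_sqrt_pi_mul_volume_le hD htr hrR hR hρ)
    (by linarith)).trans ?_
  refine (setLIntegral_rpow_le_measure_rpow_mul volume hp hρ.1 _).trans_eq ?_
  rw [hdiff]

theorem IsQHomeo.two_mul_sqrt_pi_mul_volume_le {p : ℝ} {D : Set ℂ} {Q : ℂ → ℝ≥0∞} {f : ℂ → ℂ}
    (hf : IsQHomeo p D Q f) (hp : 1 < p) (hD : IsOpen D) (hQ : Measurable Q) {z₀ : ℂ} {t r R : ℝ}
    (ht : 0 < t) (htr : t < r) (hrR : r < R) (hR : closedBall z₀ R ⊆ D) :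
    2 * (ENNReal.ofReal Real.pi * volume (f '' closedBall z₀ t)) ^ ((1 : ℝ) / 2) ≤
      ENNReal.ofReal ((2 * Real.pi) ^ (1 / p)) *
        ((volume (f '' closedBall z₀ R) - volume (f '' closedBall z₀ t)) ^ ((p - 1) / p) /
          ENNReal.ofReal (Real.log (R / r))) *
        (∫⁻ τ in Icc t R, ENNReal.ofReal (τ ^ (1 - p)) * circleMean Q z₀ τ) ^ (1 / p) := by
  have hp0 : 0 < p := by linarith
  have hr : 0 < r := ht.trans htr
  have hL : 0 < Real.log (R / r) := Real.log_pos ((one_lt_div hr).2 hrR)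
  have hΓ : CurveFamilyIn (crossingCurves z₀ r R) D := fun γ hγ => ⟨hγ.1, fun s hs =>
    hR (by simpa [dist_eq_norm] using (hγ.2.1 s hs).2)⟩
  have hadm : IsAdmissible (ringDensity z₀ r R) (crossingCurves z₀ r R) :=
    ⟨measurable_ringDensity z₀ r R, fun γ hγ =>
      one_le_lineIntegral_ringDensity hr hrR hγ.2.1 hγ.2.2.1 hγ.2.2.2⟩
  have hmod : pModulus p ((fun γ => f ∘ γ) '' crossingCurves z₀ r R) ≤
      ENNReal.ofReal (2 * Real.pi) / ENNReal.ofReal (Real.log (R / r)) ^ p *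
        ∫⁻ τ in Icc t R, ENNReal.ofReal (τ ^ (1 - p)) * circleMean Q z₀ τ := by
    refine (hf.2 _ hΓ _ hadm).trans ((setLIntegral_le_lintegral _ _).trans ?_)
    rw [lintegral_mul_ringDensity_rpow hp0 hQ z₀ hr hrR]
    gcongr
  have h := (hf.1.rpow_two_mul_sqrt_pi_mul_volume_le_pModulus hD hp ht htr hrR hR).trans
    (mul_le_mul_right hmod _)
  have h' := ENNReal.rpow_le_rpow h (z := 1 / p) (by positivity)
  rw [← ENNReal.rpow_mul, mul_one_div_cancel hp0.ne', ENNReal.rpow_one] at h'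
  refine h'.trans_eq ?_
  have hi : 0 ≤ 1 / p := by positivity
  rw [ENNReal.mul_rpow_of_nonneg _ _ hi, ENNReal.mul_rpow_of_nonneg _ _ hi,
    ENNReal.div_rpow_of_nonneg _ _ hi, ← ENNReal.rpow_mul, ← ENNReal.rpow_mul,
    mul_one_div_cancel hp0.ne', ENNReal.rpow_one, mul_one_div,
    ENNReal.ofReal_rpow_of_nonneg Real.two_pi_pos.le hi,
    div_eq_mul_inv _ (ENNReal.ofReal (Real.log (R / r))),
    div_eq_mul_inv _ (ENNReal.ofReal (Real.log (R / r)))]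
  ring

/-- The key inequality (10) of the paper: for `0 < t < t + Δt < dist(z₀, ∂D)`,
`2 √(π |fB(z₀,t)|) ≤ (2π)^{1/p} (|fB(z₀,t+Δt)| - |fB(z₀,t)|)^{(p-1)/p} / ln((t+Δt)/t) ·
(∫_t^{t+Δt} τ^{1-p} q_{z₀}(τ) dτ)^{1/p}`. -/
theorem annuli_area_inequality
    (p : ℝ) (hp : 2 < p) (D D' : Set ℂ)
    (hDo : IsOpen D) (hDc : IsConnected D) (hDb : Bornology.IsBounded D)
    (hD'o : IsOpen D') (hD'c : IsConnected D') (hD'b : Bornology.IsBounded D')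
    (Q : ℂ → ℝ≥0∞) (hQmeas : Measurable Q)
    (f : ℂ → ℂ) (hf : IsQHomeo p D Q f) (hfD : f '' D = D')
    (z₀ : ℂ) (hz₀ : z₀ ∈ D)
    (hQloc : MeasureTheory.LocallyIntegrableOn (fun z => (Q z).toReal) (D \ {z₀}))
    (t Δt : ℝ) (ht : 0 < t) (hΔt : 0 < Δt)
    (htd : t + Δt < Metric.infDist z₀ (frontier D)) :
    2 * (ENNReal.ofReal Real.pi * volume (f '' Metric.closedBall z₀ t)) ^ ((1 : ℝ) / 2) ≤
      ENNReal.ofReal ((2 * Real.pi) ^ (1 / p)) *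
        ((volume (f '' Metric.closedBall z₀ (t + Δt)) -
            volume (f '' Metric.closedBall z₀ t)) ^ ((p - 1) / p) /
          ENNReal.ofReal (Real.log ((t + Δt) / t))) *
        (∫⁻ τ in Set.Icc t (t + Δt),
            ENNReal.ofReal (τ ^ (1 - p)) * circleMean Q z₀ τ) ^ (1 / p) := by
  have hR := closedBall_subset_of_lt_infDist_frontier hz₀ htd
  have htR : t < t + Δt := by linarith
  have hcont : Filter.Tendsto (fun r : ℝ => ENNReal.ofReal (Real.log ((t + Δt) / r)))
      (nhdsWithin t (Ioi t)) (nhds (ENNReal.ofReal (Real.log ((t + Δt) / t)))) := by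
    refine ENNReal.tendsto_ofReal (ContinuousAt.tendsto ?_ |>.mono_left nhdsWithin_le_nhds)
    exact (continuousAt_const.div continuousAt_id ht.ne').log (div_pos (ht.trans htR) ht).ne'
  have hcomm : ∀ K A L I : ℝ≥0∞, K * (A / L) * I = K * A * I / L := fun K A L I => by
    simp only [div_eq_mul_inv]
    ring
  rw [hcomm]
  refine ge_of_tendsto (ENNReal.Tendsto.const_div hcont (Or.inl ENNReal.ofReal_ne_top)) ?_
  filter_upwards [Ioo_mem_nhdsGT htR] with r hr
  rw [← hcomm]
  exact hf.two_mul_sqrt_pi_mul_volume_le (by linarith) hDo hQmeas ht hr.1 hr.2 hR
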